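/- Let f : [0,1] → ℝ be a C² convex function with f(0) = 0 and f'(0) = 0. Suppose there exist m, M > 0 and an integer k ≥ 2 such that for all r ∈ [0,1], ∑_{j=2}^{k} |f^{(j)}(r)|/j! ≥ m and max_{0 ≤ j ≤ 2k+5} |f^{(j)}(r)| ≤ M (assuming f is C^{2k+5}). Then there exist constants c, C > 0 depending only on k, m, M such that for all r ∈ [0,1]: c (∑_{j=2}^{k} |f^{(j)}(0)| r^j / j! + M r^{k+1}) ≤ f(r) ≤ C (∑_{j=2}^{k} |f^{(j)}(0)| r^j / j! + M r^{k+1}). -/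

import Mathlib

open Finset in
/-- The coefficients of a real polynomial of degree at most `k` are controlled by its supremum
over the unit interval. -/
theorem exists_sum_abs_coeff_le (k : ℕ) :
    ∃ K : ℝ, 0 < K ∧ ∀ (b : ℕ → ℝ) (A : ℝ), 0 ≤ A →
      (∀ t ∈ Set.Icc (0 : ℝ) 1, |∑ j ∈ range (k + 1), b j * t ^ j| ≤ A) →
      ∑ j ∈ range (k + 1), |b j| ≤ K * A := by
  let v : Fin (k + 1) → ℝ := fun i => (i : ℝ) / (k + 1)
  have hv : Function.Injective v := by
    intro i j hij
    have hk : (k : ℝ) + 1 ≠ 0 := by positivity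
    have : (i : ℝ) = j := by simpa [v, div_left_inj' hk] using hij
    exact Fin.ext (by exact_mod_cast this)
  have hker : LinearMap.ker (Matrix.vandermonde v).mulVecLin = ⊥ := by
    rw [LinearMap.ker_eq_bot']
    intro b hb
    exact Matrix.eq_zero_of_mulVec_eq_zero (Matrix.det_vandermonde_ne_zero_iff.2 hv) hb
  obtain ⟨K, hK, hL⟩ := LinearMap.exists_antilipschitzWith _ hker
  refine ⟨(k + 1) * K, by positivity, fun b A hA hb => ?_⟩
  have hnorm := hL.le_mul_dist (fun i => b i) 0
  rw [map_zero, dist_zero_right, dist_zero_right] at hnorm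
  have hLA : ‖(Matrix.vandermonde v).mulVecLin (fun i => b i)‖ ≤ A := by
    rw [pi_norm_le_iff_of_nonneg hA]
    intro i
    have hi : v i ∈ Set.Icc (0 : ℝ) 1 := by
      refine ⟨by positivity, ?_⟩
      have : (i : ℝ) ≤ k := by exact_mod_cast Nat.lt_succ_iff.1 i.2
      exact (div_le_one (by positivity)).2 (by linarith)
    convert hb (v i) hi
    rw [← Fin.sum_univ_eq_sum_range (fun j => b j * v i ^ j)]
    simp [Matrix.mulVec, dotProduct, Matrix.vandermonde_apply, mul_comm]
  calc ∑ j ∈ range (k + 1), |b j| = ∑ i : Fin (k + 1), |b i| :=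
        (Fin.sum_univ_eq_sum_range (fun j => |b j|) _).symm
    _ ≤ ∑ _i : Fin (k + 1), K * A := by
        refine sum_le_sum fun i _ => ?_
        exact (norm_le_pi_norm (fun i : Fin (k + 1) => b i) i).trans
          (hnorm.trans (by gcongr))
    _ = (k + 1) * K * A := by simp [mul_assoc]

/-- Taylor's formula at `0` on the unit interval with a uniform bound on the remainder. -/
theorem abs_sub_taylor_le {f : ℝ → ℝ} {k : ℕ} {M : ℝ} (hf : ContDiff ℝ (k + 1 : ℕ) f)
    (hM : ∀ r ∈ Set.Icc (0 : ℝ) 1, |iteratedDeriv (k + 1) f r| ≤ M)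
    {x : ℝ} (hx : x ∈ Set.Icc (0 : ℝ) 1) :
    |f x - ∑ j ∈ Finset.range (k + 1), iteratedDeriv j f 0 * x ^ j / (Nat.factorial j)|
      ≤ M * x ^ (k + 1) := by
  have hu : UniqueDiffOn ℝ (Set.Icc (0 : ℝ) 1) := uniqueDiffOn_Icc one_pos
  have hM0 : 0 ≤ M := (abs_nonneg _).trans (hM x hx)
  have h := taylor_mean_remainder_bound (n := k) (C := M) zero_le_one
    (by exact_mod_cast hf.contDiffOn) hx fun y hy => by
      rw [iteratedDerivWithin_eq_iteratedDeriv hu hf.contDiffAt hy]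
      exact hM y hy
  rw [taylor_within_apply, sub_zero, Real.norm_eq_abs] at h
  have hsum : ∑ j ∈ Finset.range (k + 1), iteratedDeriv j f 0 * x ^ j / (Nat.factorial j) =
      ∑ j ∈ Finset.range (k + 1),
        ((Nat.factorial j : ℝ)⁻¹ * x ^ j) • iteratedDerivWithin j f (Set.Icc 0 1) 0 := by
    refine Finset.sum_congr rfl fun j hj => ?_
    have hjk : j ≤ k + 1 := (Finset.mem_range.1 hj).le
    rw [iteratedDerivWithin_eq_iteratedDeriv hu
      (hf.of_le (by exact_mod_cast hjk)).contDiffAt (by simp), smul_eq_mul]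
    ring
  rw [hsum]
  refine h.trans (div_le_self (mul_nonneg hM0 (pow_nonneg hx.1 _)) ?_)
  exact_mod_cast Nat.one_le_iff_ne_zero.2 (Nat.factorial_ne_zero k)

/-- A convex function on the unit interval vanishing to second order at `0` is nonnegative. -/
theorem nonneg_of_convexOn_of_deriv_eq_zero {f : ℝ → ℝ} (hf : DifferentiableAt ℝ f 0)
    (hconv : ConvexOn ℝ (Set.Icc (0 : ℝ) 1) f) (h0 : f 0 = 0) (h1 : deriv f 0 = 0)
    {x : ℝ} (hx : x ∈ Set.Icc (0 : ℝ) 1) : 0 ≤ f x := by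
  rcases hx.1.eq_or_lt with rfl | hpos
  · exact h0.ge
  · have h := hconv.deriv_le_slope (by simp) hx hpos hf
    rw [h1, slope_def_field, h0, sub_zero, sub_zero] at h
    simpa [hpos.ne'] using mul_nonneg h hpos.le

/-- A nonnegative convex function vanishing at `0` is nondecreasing on the unit interval. -/
theorem le_of_convexOn_of_nonneg {f : ℝ → ℝ} (hconv : ConvexOn ℝ (Set.Icc (0 : ℝ) 1) f)
    (h0 : f 0 = 0) (hnn : ∀ x ∈ Set.Icc (0 : ℝ) 1, 0 ≤ f x)
    {t r : ℝ} (ht : t ∈ Set.Icc (0 : ℝ) 1) (hr : r ∈ Set.Icc (0 : ℝ) 1) : f (r * t) ≤ f r := by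
  have h := hconv.2 (x := r) (y := 0) hr (by simp) ht.1 (sub_nonneg.2 ht.2) (by ring)
  simp only [smul_eq_mul, mul_zero, add_zero, h0, mul_comm t r] at h
  exact h.trans (mul_le_of_le_one_left (hnn r hr) ht.2)

theorem stmt_0 (k : ℕ) (hk : 2 ≤ k) (m M : ℝ) (hm : 0 < m) (hM : 0 < M) :
    ∃ c C : ℝ, 0 < c ∧ 0 < C ∧
      ∀ f : ℝ → ℝ, ContDiff ℝ (2 * k + 5 : ℕ) f →
        ConvexOn ℝ (Set.Icc (0 : ℝ) 1) f →
        f 0 = 0 → deriv f 0 = 0 →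
        (∀ r ∈ Set.Icc (0 : ℝ) 1,
          m ≤ ∑ j ∈ Finset.Icc 2 k, |iteratedDeriv j f r| / (Nat.factorial j)) →
        (∀ r ∈ Set.Icc (0 : ℝ) 1, ∀ j ≤ 2 * k + 5,
          |iteratedDeriv j f r| ≤ M) →
        ∀ r ∈ Set.Icc (0 : ℝ) 1,
          c * (∑ j ∈ Finset.Icc 2 k, |iteratedDeriv j f 0| * r ^ j / (Nat.factorial j)
                + M * r ^ (k + 1)) ≤ f r ∧
          f r ≤ C * (∑ j ∈ Finset.Icc 2 k, |iteratedDeriv j f 0| * r ^ j / (Nat.factorial j)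
                + M * r ^ (k + 1)) := by
  obtain ⟨K, hK, hcoeff⟩ := exists_sum_abs_coeff_le k
  set r₀ : ℝ := min 1 (m / (2 * K * M))
  have hr₀pos : 0 < r₀ := by positivity
  have hr₀one : r₀ ≤ 1 := min_le_left _ _
  refine ⟨r₀ ^ k / (2 * K * (1 + M / m)), 1, by positivity, one_pos, ?_⟩
  intro f hf hconv h0 h1 hlow hup
  have hnn : ∀ x ∈ Set.Icc (0 : ℝ) 1, 0 ≤ f x := fun x hx =>
    nonneg_of_convexOn_of_deriv_eq_zero
      (hf.differentiable (by norm_cast)).differentiableAt hconv h0 h1 hx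
  have htaylor : ∀ x ∈ Set.Icc (0 : ℝ) 1, _ := fun x hx =>
    abs_sub_taylor_le (k := k) (M := M) (hf.of_le (by norm_cast; omega))
      (fun r hr => hup r hr _ (by omega)) hx
  have hrange : ∀ g : ℕ → ℝ, g 0 = 0 → g 1 = 0 →
      ∑ j ∈ Finset.range (k + 1), g j = ∑ j ∈ Finset.Icc 2 k, g j := by
    intro g hg0 hg1
    symm
    refine Finset.sum_subset (fun j hj => ?_) fun j hj hj' => ?_
    · simp only [Finset.mem_Icc, Finset.mem_range] at *; omega
    · simp only [Finset.mem_Icc, Finset.mem_range] at *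
      obtain rfl | rfl : j = 0 ∨ j = 1 := by omega
      exacts [hg0, hg1]
  set S : ℝ → ℝ := fun r =>
    ∑ j ∈ Finset.Icc 2 k, |iteratedDeriv j f 0| * r ^ j / (Nat.factorial j) with hS
  have hSnn : ∀ r, 0 ≤ r → 0 ≤ S r := fun r hr => by simp only [hS]; positivity
  have hSrem : ∀ r ∈ Set.Icc (0 : ℝ) 1, M * r ^ (k + 1) ≤ M / m * r * S r := by
    intro r hr
    have hmS : m * r ^ k ≤ S r := by
      refine (mul_le_mul_of_nonneg_right (hlow 0 (by simp)) (pow_nonneg hr.1 k)).trans ?_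
      rw [Finset.sum_mul]
      refine Finset.sum_le_sum fun j hj => ?_
      have hpow : r ^ k ≤ r ^ j := pow_le_pow_of_le_one hr.1 hr.2 (Finset.mem_Icc.1 hj).2
      rw [div_mul_eq_mul_div]
      exact div_le_div_of_nonneg_right (mul_le_mul_of_nonneg_left hpow (abs_nonneg _))
        (Nat.cast_nonneg _)
    calc M * r ^ (k + 1) = M / m * r * (m * r ^ k) := by
          field_simp
          ring
      _ ≤ M / m * r * S r := by
        have := hr.1
        gcongr
  have hSf : ∀ r ∈ Set.Icc (0 : ℝ) 1, S r ≤ K * (f r + M * r ^ (k + 1)) := by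
    intro r hr
    have h := hcoeff (fun j => iteratedDeriv j f 0 * r ^ j / (Nat.factorial j))
      (f r + M * r ^ (k + 1))
      (add_nonneg (hnn r hr) (mul_nonneg hM.le (pow_nonneg hr.1 _))) ?_
    · rw [hrange _ (by simp [h0]) (by simp [h1])] at h
      simpa [hS, abs_div, abs_mul, abs_of_nonneg hr.1] using h
    · intro t ht
      have hrt : r * t ∈ Set.Icc (0 : ℝ) 1 :=
        ⟨mul_nonneg hr.1 ht.1, mul_le_one₀ hr.2 ht.1 ht.2⟩
      have hT := htaylor _ hrt
      rw [abs_sub_comm] at hT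
      have heq : ∑ j ∈ Finset.range (k + 1),
            iteratedDeriv j f 0 * r ^ j / (Nat.factorial j) * t ^ j =
          ∑ j ∈ Finset.range (k + 1),
            iteratedDeriv j f 0 * (r * t) ^ j / (Nat.factorial j) :=
        Finset.sum_congr rfl fun j _ => by ring
      rw [heq]
      have hpow : M * (r * t) ^ (k + 1) ≤ M * r ^ (k + 1) := by
        have := hrt.1
        gcongr
        exact mul_le_of_le_one_right hr.1 ht.2
      have hmono := le_of_convexOn_of_nonneg hconv h0 hnn ht hr
      have habs := abs_le.1 hT
      have hfrt := hnn _ hrt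
      exact abs_le.2 ⟨by linarith, by linarith⟩
  have hsmall : ∀ r ∈ Set.Icc (0 : ℝ) 1, r ≤ r₀ → S r ≤ 2 * K * f r := by
    intro r hr hrr
    have hr' : r ≤ m / (2 * K * M) := hrr.trans (min_le_right _ _)
    have hKr : K * (M / m * r) ≤ 1 / 2 := by
      calc K * (M / m * r) ≤ K * (M / m * (m / (2 * K * M))) := by gcongr
        _ = 1 / 2 := by field_simp
    have hmul := mul_le_mul_of_nonneg_right hKr (hSnn r hr.1)
    have hrem := mul_le_mul_of_nonneg_left (hSrem r hr) hK.le
    have := hSf r hr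
    linarith
  have hmain : ∀ r ∈ Set.Icc (0 : ℝ) 1, r₀ ^ k * S r ≤ 2 * K * f r := by
    intro r hr
    rcases le_total r r₀ with hrr | hrr
    · exact (mul_le_of_le_one_left (hSnn r hr.1) (pow_le_one₀ hr₀pos.le hr₀one)).trans
        (hsmall r hr hrr)
    · have hrpos : 0 < r := hr₀pos.trans_le hrr
      have hmono := le_of_convexOn_of_nonneg hconv h0 hnn (t := r₀ / r) (r := r)
        ⟨by positivity, (div_le_one hrpos).2 hrr⟩ hr
      rw [mul_div_cancel₀ _ hrpos.ne'] at hmono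
      calc r₀ ^ k * S r ≤ S r₀ := by
            simp only [hS, Finset.mul_sum]
            refine Finset.sum_le_sum fun j hj => ?_
            have hj' : r₀ ^ k * r ^ j ≤ r₀ ^ j :=
              (mul_le_of_le_one_right (by positivity) (pow_le_one₀ hr.1 hr.2)).trans
                (pow_le_pow_of_le_one hr₀pos.le hr₀one (Finset.mem_Icc.1 hj).2)
            rw [← mul_div_assoc, mul_left_comm]
            gcongr
        _ ≤ 2 * K * f r₀ := hsmall r₀ ⟨hr₀pos.le, hr₀one⟩ le_rfl
        _ ≤ 2 * K * f r := by gcongr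
  intro r hr
  constructor
  · change r₀ ^ k / (2 * K * (1 + M / m)) * (S r + M * r ^ (k + 1)) ≤ f r
    have hbound : S r + M * r ^ (k + 1) ≤ (1 + M / m) * S r := by
      have hle : M / m * r * S r ≤ M / m * S r :=
        mul_le_mul_of_nonneg_right (mul_le_of_le_one_right (by positivity) hr.2) (hSnn r hr.1)
      have := hSrem r hr
      linarith
    calc r₀ ^ k / (2 * K * (1 + M / m)) * (S r + M * r ^ (k + 1))
        ≤ r₀ ^ k / (2 * K * (1 + M / m)) * ((1 + M / m) * S r) := by gcongr
      _ = r₀ ^ k * S r / (2 * K) := by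
        have : 1 + M / m ≠ 0 := by positivity
        field_simp
      _ ≤ f r := by
        rw [div_le_iff₀ (by positivity), mul_comm (f r)]
        exact hmain r hr
  · rw [one_mul]
    have hT := (abs_le.1 (htaylor r hr)).2
    rw [hrange _ (by simp [h0]) (by simp [h1])] at hT
    have hle : ∑ j ∈ Finset.Icc 2 k, iteratedDeriv j f 0 * r ^ j / (Nat.factorial j) ≤
        ∑ j ∈ Finset.Icc 2 k, |iteratedDeriv j f 0| * r ^ j / (Nat.factorial j) := by
      have := hr.1
      gcongr
      exact le_abs_self _
    linarith
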